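/- arXiv:2101.06192 — 3 statements merged into one kernel-verified Lean document; each statement's English description precedes it below -/
import Mathlib

section
/- For every vertex u ∈ V of G, the forest farness of u in G equals the sum of effective resistances in the augmented graph G_star from u to all other original vertices: ∑_{v ∈ V, v ≠ u} f_α(u, v) = ∑_{v ∈ V, v ≠ u} R_{G_star}(u, v). -/
open Matrix

variable {V : Type*} [Fintype V] [DecidableEq V]

/-- The weighted Laplacian matrix `L = D - W` of a weighted graph given by its
(symmetric, nonnegative, zero-diagonal) weight matrix `W`. -/
def lap (W : Matrix V V ℝ) : Matrix V V ℝ :=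
  Matrix.diagonal (fun v => ∑ u, W v u) - W

/-- The forest distance `f_α(u,v) = (e_u - e_v)ᵀ (αL + I)⁻¹ (e_u - e_v)`. -/
noncomputable def forestDist (α : ℝ) (W : Matrix V V ℝ) (u v : V) : ℝ :=
  (Pi.single u 1 - Pi.single v 1) ⬝ᵥ ((α • lap W + 1)⁻¹ *ᵥ (Pi.single u 1 - Pi.single v 1))

/-- The Laplacian of the augmented graph `G_star`: the `V × V` block equals `αL + I`,
the new universal vertex `none` has diagonal entry `n` and off-diagonal entries `-1`. -/
noncomputable def lapStar (α : ℝ) (W : Matrix V V ℝ) : Matrix (Option V) (Option V) ℝ :=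
  Matrix.of fun i j =>
    match i, j with
    | none, none => (Fintype.card V : ℝ)
    | none, some _ => -1
    | some _, none => -1
    | some u, some v => (α • lap W + 1) u v

/-- The forest matrix is a genuine inverse: `αL + I` is strictly diagonally dominant. -/
theorem isUnit_det_smul_lap_add_one {W : Matrix V V ℝ} (hnn : ∀ u v, 0 ≤ W u v)
    {α : ℝ} (hα : 0 ≤ α) : IsUnit (α • lap W + 1).det := by
  refine isUnit_iff_ne_zero.mpr (det_ne_zero_of_sum_row_lt_diag fun k => ?_)
  have hoff : ∀ j ∈ Finset.univ.erase k, ‖(α • lap W + 1) k j‖ = α * W k j := by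
    intro j hj
    have hkj : k ≠ j := (Finset.ne_of_mem_erase hj).symm
    simp [lap, hkj, abs_of_nonneg hα, abs_of_nonneg (hnn k j)]
  have hdiag : (α • lap W + 1) k k = α * ∑ j ∈ Finset.univ.erase k, W k j + 1 := by
    simp [lap, Finset.sum_erase_eq_sub]
  rw [Finset.sum_congr rfl hoff, hdiag, ← Finset.mul_sum]
  exact (lt_add_one _).trans_le (le_abs_self _)

/-- Constant vectors are fixed by `αL + I`, since they lie in the kernel of the Laplacian. -/
theorem smul_lap_add_one_mulVec_const (W : Matrix V V ℝ) (α c : ℝ) :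
    (α • lap W + 1) *ᵥ (fun _ => c) = fun _ => c := by
  have hlap : lap W *ᵥ (fun _ => c) = 0 := by
    ext i
    rw [lap, sub_mulVec, Pi.sub_apply, mulVec_diagonal, mulVec, dotProduct, Finset.sum_mul,
      sub_self, Pi.zero_apply]
  rw [add_mulVec, smul_mulVec, hlap, smul_zero, one_mulVec, zero_add]

/-- On original vertices, `L_star` acts by applying `αL + I` to the potentials
measured relative to the universal vertex. -/
theorem lapStar_mulVec_some (α : ℝ) (W : Matrix V V ℝ) (x : Option V → ℝ) (i : V) :
    (lapStar α W *ᵥ x) (some i) = ((α • lap W + 1) *ᵥ fun j => x (some j) - x none) i := by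
  have hsub : (fun j => x (some j) - x none) = (fun j => x (some j)) - fun _ => x none := rfl
  rw [hsub, mulVec_sub, smul_lap_add_one_mulVec_const, Pi.sub_apply]
  simp only [mulVec, dotProduct, Fintype.sum_option, lapStar, of_apply]
  ring

/-- The forest distance is the effective resistance in the augmented graph. -/
theorem forestDist_eq_effectiveResistance {W : Matrix V V ℝ} (hnn : ∀ u v, 0 ≤ W u v)
    {α : ℝ} (hα : 0 ≤ α) {u v : V} {x : Option V → ℝ}
    (hx : lapStar α W *ᵥ x = Pi.single (some u) 1 - Pi.single (some v) 1) :
    forestDist α W u v = (Pi.single (some u) 1 - Pi.single (some v) 1) ⬝ᵥ x := by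
  have hy : (α • lap W + 1) *ᵥ (fun j => x (some j) - x none)
      = Pi.single u 1 - Pi.single v 1 := by
    ext i
    rw [← lapStar_mulVec_some, hx]
    simp [Pi.single_apply]
  rw [forestDist, ← hy, mulVec_mulVec, nonsing_inv_mul _ (isUnit_det_smul_lap_add_one hnn hα),
    one_mulVec, hy]
  simp [sub_dotProduct]

/-- for every vertex `u` of `G`, the forest farness of `u` equals the sum of
effective resistances in the augmented graph `G_star` from `u` to all other original vertices:
`∑_{v ≠ u} f_α(u,v) = ∑_{v ≠ u} R_{G_star}(u,v)`, where `R_{G_star}(u,v) = (e_u - e_v)ᵀ x v`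
for any solution `x v` of `L_star (x v) = e_u - e_v`. -/
theorem forestFarness_eq_sum_effectiveResistances
    (W : Matrix V V ℝ) (hsym : ∀ u v, W u v = W v u) (hnn : ∀ u v, 0 ≤ W u v)
    (hdiag : ∀ v, W v v = 0) (α : ℝ) (hα : 0 < α) (u : V)
    (x : V → Option V → ℝ)
    (hx : ∀ v : V, lapStar α W *ᵥ x v = Pi.single (some u) 1 - Pi.single (some v) 1) :
    ∑ v ∈ Finset.univ.erase u, forestDist α W u v
      = ∑ v ∈ Finset.univ.erase u,
          (Pi.single (some u) 1 - Pi.single (some v) 1) ⬝ᵥ x v := by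
  exact Finset.sum_congr rfl fun v _ => forestDist_eq_effectiveResistance hnn hα.le (hx v)
end

section
/- For every pair of vertices u, v ∈ V of G, the forest distance is bounded by 2: f_α(u, v) = Ω[u, u] + Ω[v, v] − 2 Ω[u, v] ≤ 2. -/
open Matrix

variable {V : Type*} [Fintype V] [DecidableEq V]

theorem dotProduct_lap_mulVec (W : Matrix V V ℝ) (hsym : ∀ u v, W u v = W v u) (y : V → ℝ) :
    y ⬝ᵥ (lap W *ᵥ y) = (∑ i, ∑ j, W i j * (y i - y j) ^ 2) / 2 := by
  have hswap : ∑ i, ∑ j, W i j * y j ^ 2 = ∑ i, ∑ j, W i j * y i ^ 2 := by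
    rw [Finset.sum_comm]
    exact Finset.sum_congr rfl fun i _ => Finset.sum_congr rfl fun j _ => by rw [hsym]
  have hexpand : ∑ i, ∑ j, W i j * (y i - y j) ^ 2
      = ∑ i, ∑ j, W i j * y i ^ 2 + ∑ i, ∑ j, W i j * y j ^ 2
        - 2 * ∑ i, ∑ j, y i * (W i j * y j) := by
    simp only [Finset.mul_sum, ← Finset.sum_add_distrib, ← Finset.sum_sub_distrib]
    exact Finset.sum_congr rfl fun i _ => Finset.sum_congr rfl fun j _ => by ring
  have hquad : y ⬝ᵥ (lap W *ᵥ y)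
      = ∑ i, ∑ j, W i j * y i ^ 2 - ∑ i, ∑ j, y i * (W i j * y j) := by
    rw [lap, Matrix.sub_mulVec, dotProduct_sub]
    congr 1
    · simp only [dotProduct, Matrix.mulVec_diagonal, Finset.mul_sum, Finset.sum_mul]
      exact Finset.sum_congr rfl fun i _ => Finset.sum_congr rfl fun j _ => by ring
    · simp only [dotProduct, Matrix.mulVec, Finset.mul_sum]
  rw [hquad, hexpand, hswap]
  ring

theorem lap_isHermitian (W : Matrix V V ℝ) (hsym : ∀ u v, W u v = W v u) :
    (lap W).IsHermitian :=
  (Matrix.isHermitian_diagonal _).sub (Matrix.IsHermitian.ext fun i j => by simp [hsym j i])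

theorem lap_posSemidef (W : Matrix V V ℝ) (hsym : ∀ u v, W u v = W v u)
    (hnn : ∀ u v, 0 ≤ W u v) : (lap W).PosSemidef := by
  refine Matrix.PosSemidef.of_dotProduct_mulVec_nonneg (lap_isHermitian W hsym) fun y => ?_
  rw [star_trivial, dotProduct_lap_mulVec W hsym]
  exact div_nonneg (Finset.sum_nonneg fun i _ => Finset.sum_nonneg fun j _ =>
    mul_nonneg (hnn i j) (sq_nonneg _)) zero_le_two

/-- For `P` positive semidefinite, `(P + 1)⁻¹ ≤ 1` as quadratic forms. -/
theorem dotProduct_inv_add_one_mulVec_le {P : Matrix V V ℝ} (hP : P.PosSemidef) (x : V → ℝ) :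
    x ⬝ᵥ ((P + 1)⁻¹ *ᵥ x) ≤ x ⬝ᵥ x := by
  have hunit : IsUnit (P + 1).det :=
    (Matrix.isUnit_iff_isUnit_det _).mp (Matrix.PosDef.posSemidef_add hP Matrix.PosDef.one).isUnit
  set y := (P + 1)⁻¹ *ᵥ x with hy
  have hx : x = P *ᵥ y + y := by
    rw [hy, ← Matrix.one_mulVec ((P + 1)⁻¹ *ᵥ x), Matrix.mulVec_mulVec, Matrix.mul_one,
      ← Matrix.add_mulVec, Matrix.mulVec_mulVec, Matrix.mul_nonsing_inv _ hunit, Matrix.one_mulVec]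
  have hPy : 0 ≤ y ⬝ᵥ (P *ᵥ y) := by simpa using hP.dotProduct_mulVec_nonneg y
  have hPP : 0 ≤ (P *ᵥ y) ⬝ᵥ (P *ᵥ y) := Finset.sum_nonneg fun i _ => mul_self_nonneg _
  have hcomm := dotProduct_comm (P *ᵥ y) y
  rw [hx]
  simp only [add_dotProduct, dotProduct_add]
  linarith

/-- for every pair of vertices `u, v`, the forest distance satisfies
`f_α(u,v) = Ω[u,u] + Ω[v,v] - 2Ω[u,v] ≤ 2`, where `Ω = (αL + I)⁻¹`. -/
theorem forestDist_eq_and_le_two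
    (W : Matrix V V ℝ) (hsym : ∀ u v, W u v = W v u) (hnn : ∀ u v, 0 ≤ W u v)
    (hdiag : ∀ v, W v v = 0) (α : ℝ) (hα : 0 < α) (u v : V) :
    forestDist α W u v
      = (α • lap W + 1)⁻¹ u u + (α • lap W + 1)⁻¹ v v - 2 * (α • lap W + 1)⁻¹ u v ∧
    forestDist α W u v ≤ 2 := by
  have hP : (α • lap W).PosSemidef := (lap_posSemidef W hsym hnn).smul hα.le
  constructor
  · have hΩ : (α • lap W + 1)⁻¹ v u = (α • lap W + 1)⁻¹ u v := by
      simpa using (hP.isHermitian.add Matrix.isHermitian_one).inv.apply u v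
    simp only [forestDist, Matrix.mulVec_sub, dotProduct_sub, sub_dotProduct,
      Matrix.mulVec_single_one, single_one_dotProduct, Matrix.col_apply, hΩ]
    ring
  · refine (dotProduct_inv_add_one_mulVec_le hP _).trans ?_
    by_cases huv : u = v
    · simp [huv]
    · simp [dotProduct_sub, huv, Ne.symm huv]
      norm_num
end

section
/- Let f(S) = trace((L_star_{−S})^{-1}) be the group forest farness, let k ≥ 2, let v_0 be a vertex minimizing f over all singletons, and let S_1 ⊆ S_2 ⊆ … ⊆ S_k be a greedy sequence, i.e., S_1 = {v_0} and for each i, S_{i+1} = S_i ∪ {v_i} where v_i ∈ V ∖ S_i maximizes the marginal gain f(S_i) − f(S_i ∪ {v}) over v ∈ V ∖ S_i. Then f({v_0}) − f(S_k) ≥ (1 − k/(e·(k − 1))) · (f({v_0}) − f(S̃)), where S̃ is a subset of V of size k minimizing f among all size-k subsets and e is Euler's number. -/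
open Matrix

variable {V : Type*} [Fintype V] [DecidableEq V]

/-- The group forest farness `f(S) = trace((L_star_{-S})⁻¹)`, where `L_star_{-S}` is the
principal submatrix of `L_star` obtained by deleting all rows and columns with indices
in `S` (the universal vertex is never deleted). -/
noncomputable def gff (α : ℝ) (W : Matrix V V ℝ) (S : Finset V) : ℝ :=
  Matrix.trace (((lapStar α W).submatrix
    (Subtype.val : {x : Option V // x ∉ S.image some} → Option V) Subtype.val)⁻¹)

/-- A symmetric matrix with zero row sums and nonpositive off-diagonal entries (a weighted graph
Laplacian) in which the vertex `z` is adjacent to every other vertex. -/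
structure IsHubLaplacian {ι : Type*} [Fintype ι] (L : Matrix ι ι ℝ) (z : ι) : Prop where
  symm : ∀ x y, L x y = L y x
  offDiag_nonpos : ∀ x y, x ≠ y → L x y ≤ 0
  row_sum : ∀ x, ∑ y, L x y = 0
  hub_neg : ∀ x, x ≠ z → L x z < 0

/-- The inverse of the principal submatrix of `L` off `S`, extended by zero. -/
noncomputable def green {ι : Type*} [Fintype ι] [DecidableEq ι] (L : Matrix ι ι ℝ)
    (S : Finset ι) : Matrix ι ι ℝ := fun x y =>
  if h : x ∉ S ∧ y ∉ S then
    (L.submatrix (Subtype.val : {x : ι // x ∉ S} → ι)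
      (Subtype.val : {x : ι // x ∉ S} → ι))⁻¹ ⟨x, h.1⟩ ⟨y, h.2⟩
  else 0

section Green

variable {ι : Type*} [Fintype ι] {L : Matrix ι ι ℝ} {z : ι} {S T : Finset ι}

namespace IsHubLaplacian

theorem mulVec_eq (hL : IsHubLaplacian L z) (u : ι → ℝ) (x : ι) :
    (L *ᵥ u) x = ∑ y, L x y * (u y - u x) := by
  simp only [mul_sub, Finset.sum_sub_distrib, ← Finset.sum_mul, hL.row_sum, zero_mul, sub_zero]
  rfl

theorem summand_nonpos (hL : IsHubLaplacian L z) {u : ι → ℝ} {x : ι} (hx : ∀ y, u x ≤ u y)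
    (y : ι) : L x y * (u y - u x) ≤ 0 := by
  rcases eq_or_ne x y with rfl | hxy
  · simp
  · exact mul_nonpos_of_nonpos_of_nonneg (hL.offDiag_nonpos x y hxy) (sub_nonneg.2 (hx y))

/-- The minimum principle: a function superharmonic off `S` and nonnegative on `S` is
nonnegative. -/
theorem nonneg_of_mulVec_nonneg (hL : IsHubLaplacian L z) (hS : S.Nonempty) {u : ι → ℝ}
    (hsuper : ∀ x ∉ S, 0 ≤ (L *ᵥ u) x) (hbd : ∀ x ∈ S, 0 ≤ u x) (x : ι) : 0 ≤ u x := by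
  obtain ⟨s, hs⟩ := hS
  obtain ⟨m, -, hm⟩ := Finset.exists_min_image Finset.univ u ⟨s, Finset.mem_univ s⟩
  have hm (y : ι) : u m ≤ u y := hm y (Finset.mem_univ y)
  by_contra! hneg
  have hmneg : u m < 0 := (hm x).trans_lt hneg
  have flat (a : ι) (ha : u a = u m) (y : ι) : L a y * (u y - u a) = 0 := by
    have hmin : ∀ y, u a ≤ u y := fun y => ha ▸ hm y
    have haS : a ∉ S := fun h => by linarith [hbd a h]
    have h0 : ∑ y, L a y * (u y - u a) = 0 :=
      le_antisymm (Finset.sum_nonpos fun y _ => hL.summand_nonpos hmin y)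
        (hL.mulVec_eq u a ▸ hsuper a haS)
    exact (Finset.sum_eq_zero_iff_of_nonpos fun y _ => hL.summand_nonpos hmin y).1 h0 y
      (Finset.mem_univ y)
  have hz : u z = u m := by
    rcases eq_or_ne m z with rfl | h
    · rfl
    · have := (mul_eq_zero.1 (flat m rfl z)).resolve_left (hL.hub_neg m h).ne
      linarith
  have hsm : u s = u m := by
    rcases eq_or_ne s z with rfl | h
    · exact hz
    · have hne : L z s ≠ 0 := hL.symm z s ▸ (hL.hub_neg s h).ne
      have := (mul_eq_zero.1 (flat z hz s)).resolve_left hne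
      linarith
  linarith [hbd s hs]

/-- Uniqueness for the Dirichlet problem: two functions with the same values on `S`
and the same Laplacian off `S` coincide. -/
theorem eq_of_mulVec_eq (hL : IsHubLaplacian L z) (hS : S.Nonempty) {u w : ι → ℝ}
    (hLap : ∀ x ∉ S, (L *ᵥ u) x = (L *ᵥ w) x) (hbd : ∀ x ∈ S, u x = w x) : u = w := by
  funext x
  have h1 := hL.nonneg_of_mulVec_nonneg (u := u - w) hS
    (fun x hx => by simp [Matrix.mulVec_sub, hLap x hx]) (fun x hx => by simp [hbd x hx]) x
  have h2 := hL.nonneg_of_mulVec_nonneg (u := w - u) hS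
    (fun x hx => by simp [Matrix.mulVec_sub, hLap x hx]) (fun x hx => by simp [hbd x hx]) x
  simp only [Pi.sub_apply] at h1 h2
  linarith

end IsHubLaplacian

variable [DecidableEq ι]

theorem green_of_mem_left {x : ι} (hx : x ∈ S) (y : ι) : green L S x y = 0 := by
  simp [green, hx]

theorem green_of_mem_right {y : ι} (x : ι) (hy : y ∈ S) : green L S x y = 0 := by
  simp [green, hy]

theorem sum_compl_subtype {u : ι → ℝ} (hu : ∀ x ∈ S, u x = 0) :
    ∑ x : {x : ι // x ∉ S}, u x = ∑ x, u x := by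
  rw [← Finset.sum_subtype Sᶜ (fun x => by simp) u]
  exact Finset.sum_subset (Finset.subset_univ _) fun x _ hx => hu x (by simpa using hx)

theorem submatrix_mulVec_apply {u : ι → ℝ} (hu : ∀ x ∈ S, u x = 0) (x : {x : ι // x ∉ S}) :
    (L.submatrix (Subtype.val : {x : ι // x ∉ S} → ι) Subtype.val
        *ᵥ fun y : {x : ι // x ∉ S} => u y) x
      = (L *ᵥ u) x :=
  sum_compl_subtype (u := fun y => L x y * u y) fun y hy => by rw [hu y hy, mul_zero]

theorem trace_submatrix_inv (L : Matrix ι ι ℝ) (S : Finset ι) :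
    Matrix.trace (L.submatrix (Subtype.val : {x : ι // x ∉ S} → ι) Subtype.val)⁻¹
      = ∑ x, green L S x x := by
  rw [← sum_compl_subtype (S := S) (u := fun x => green L S x x)
    fun x hx => green_of_mem_left hx x]
  refine Finset.sum_congr rfl fun x _ => ?_
  simp [green, x.2]

namespace IsHubLaplacian

theorem isUnit_det_submatrix (hL : IsHubLaplacian L z) (hS : S.Nonempty) :
    IsUnit (L.submatrix (Subtype.val : {x : ι // x ∉ S} → ι) Subtype.val).det := by
  rw [isUnit_iff_ne_zero]
  intro hdet
  obtain ⟨v, hv, hv0⟩ := Matrix.exists_mulVec_eq_zero_iff.2 hdet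
  let u : ι → ℝ := fun x => if h : x ∉ S then v ⟨x, h⟩ else 0
  have huS : ∀ x ∈ S, u x = 0 := fun x hx => by simp [u, hx]
  have huv : (fun y : {x : ι // x ∉ S} => u y) = v := by
    funext y
    simp [u, y.2]
  have hLu : ∀ x ∉ S, (L *ᵥ u) x = 0 := fun x hx => by
    rw [← submatrix_mulVec_apply huS ⟨x, hx⟩, huv, hv0, Pi.zero_apply]
  have hu : u = 0 := hL.eq_of_mulVec_eq hS (fun x hx => by simp [hLu x hx]) huS
  exact hv (huv ▸ funext fun y => congrFun hu y)

theorem mulVec_green (hL : IsHubLaplacian L z) (hS : S.Nonempty) {x y : ι} (hx : x ∉ S)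
    (hy : y ∉ S) : (L *ᵥ fun a => green L S a y) x = if x = y then 1 else 0 := by
  rw [← submatrix_mulVec_apply (fun a ha => green_of_mem_left ha y) ⟨x, hx⟩]
  have h := congrFun (congrFun (Matrix.mul_nonsing_inv _ (hL.isUnit_det_submatrix hS))
    ⟨x, hx⟩) ⟨y, hy⟩
  rw [Matrix.one_apply] at h
  simp only [Subtype.mk.injEq] at h
  rw [← h, Matrix.mul_apply]
  refine Finset.sum_congr rfl fun a _ => ?_
  simp [green, a.2, hy]

theorem green_nonneg (hL : IsHubLaplacian L z) (hS : S.Nonempty) (x y : ι) :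
    0 ≤ green L S x y := by
  by_cases hy : y ∈ S
  · rw [green_of_mem_right x hy]
  · refine hL.nonneg_of_mulVec_nonneg (u := fun a => green L S a y) hS (fun a ha => ?_)
      (fun a ha => (green_of_mem_left ha y).ge) x
    rw [hL.mulVec_green hS ha hy]
    split_ifs <;> norm_num

theorem green_diag_pos (hL : IsHubLaplacian L z) (hS : S.Nonempty) {v : ι} (hv : v ∉ S) :
    0 < green L S v v := by
  refine (hL.green_nonneg hS v v).lt_of_ne fun h0 => ?_
  have h1 := hL.mulVec_green hS hv hv
  rw [if_pos rfl, hL.mulVec_eq] at h1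
  have h2 : ∑ y, L v y * (green L S y v - green L S v v) ≤ 0 := Finset.sum_nonpos fun y _ =>
    hL.summand_nonpos (u := fun a => green L S a v)
      (fun y => by simpa only [← h0] using hL.green_nonneg hS y v) y
  linarith

theorem green_antitone (hL : IsHubLaplacian L z) (hS : S.Nonempty) (hST : S ⊆ T) (x y : ι) :
    green L T x y ≤ green L S x y := by
  by_cases hy : y ∈ T
  · rw [green_of_mem_right x hy]
    exact hL.green_nonneg hS x y
  · refine sub_nonneg.1 (hL.nonneg_of_mulVec_nonneg
      (u := (fun a => green L S a y) - fun a => green L T a y) (hS.mono hST) (fun a ha => ?_)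
      (fun a ha => ?_) x)
    · rw [Matrix.mulVec_sub, Pi.sub_apply, hL.mulVec_green hS (fun h => ha (hST h))
        (fun h => hy (hST h)), hL.mulVec_green (hS.mono hST) ha hy, sub_self]
    · simpa [green_of_mem_left ha y] using hL.green_nonneg hS a y

theorem green_comm (hL : IsHubLaplacian L z) (x y : ι) : green L S x y = green L S y x := by
  have hsymm : (L.submatrix (Subtype.val : {x : ι // x ∉ S} → ι) Subtype.val).IsSymm :=
    Matrix.IsSymm.ext fun a b => hL.symm b a
  by_cases h : x ∉ S ∧ y ∉ S
  · simp only [green, h, dif_pos, not_false_eq_true, and_self]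
    exact hsymm.inv.apply ⟨y, h.2⟩ ⟨x, h.1⟩
  · rw [green, green, dif_neg h, dif_neg fun h' => h h'.symm]

theorem green_insert (hL : IsHubLaplacian L z) (hS : S.Nonempty) {v : ι} (hv : v ∉ S) (x y : ι) :
    green L (insert v S) x y
      = green L S x y - green L S x v * (green L S v y / green L S v v) := by
  have hvv := (hL.green_diag_pos hS hv).ne'
  by_cases hy : y ∈ insert v S
  · rw [green_of_mem_right x hy]
    rcases Finset.mem_insert.1 hy with rfl | hy
    · rw [div_self hvv, mul_one, sub_self]
    · simp [green_of_mem_right _ hy]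
  · have hyS : y ∉ S := fun h => hy (Finset.mem_insert_of_mem h)
    refine congrFun (hL.eq_of_mulVec_eq (u := fun a => green L (insert v S) a y)
      (w := (fun a => green L S a y)
        - (green L S v y / green L S v v) • fun a => green L S a v)
      (Finset.insert_nonempty v S) (fun a ha => ?_) fun a ha => ?_) x |>.trans ?_
    · have haS : a ∉ S := fun h => ha (Finset.mem_insert_of_mem h)
      have hav : a ≠ v := fun h => ha (h ▸ Finset.mem_insert_self v S)
      rw [Matrix.mulVec_sub, Matrix.mulVec_smul, Pi.sub_apply, Pi.smul_apply,
        hL.mulVec_green (Finset.insert_nonempty v S) ha hy, hL.mulVec_green hS haS hyS,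
        hL.mulVec_green hS haS hv, if_neg hav, smul_zero, sub_zero]
    · simp only [green_of_mem_left ha, Pi.sub_apply, Pi.smul_apply, smul_eq_mul]
      rcases Finset.mem_insert.1 ha with rfl | ha
      · rw [div_mul_cancel₀ _ hvv, sub_self]
      · simp [green_of_mem_left ha]
    · simp [mul_comm]

/-- The probability of hitting `v` before `S` decreases as `S` grows. -/
theorem green_div_antitone (hL : IsHubLaplacian L z) (hS : S.Nonempty) (hST : S ⊆ T) {v : ι}
    (hv : v ∉ T) (x : ι) :
    green L T x v / green L T v v ≤ green L S x v / green L S v v := by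
  have hT := hS.mono hST
  have hvS : v ∉ S := fun h => hv (hST h)
  have key := hL.nonneg_of_mulVec_nonneg (S := insert v T)
    (u := ((green L S v v)⁻¹ • fun a => green L S a v)
      - (green L T v v)⁻¹ • fun a => green L T a v)
    (Finset.insert_nonempty v T) (fun a ha => ?_) (fun a ha => ?_) x
  · simp only [Pi.sub_apply, Pi.smul_apply, smul_eq_mul] at key
    rw [div_eq_inv_mul, div_eq_inv_mul]
    exact sub_nonneg.1 key
  · have haT : a ∉ T := fun h => ha (Finset.mem_insert_of_mem h)
    have hav : a ≠ v := fun h => ha (h ▸ Finset.mem_insert_self v T)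
    rw [Matrix.mulVec_sub, Matrix.mulVec_smul, Matrix.mulVec_smul, Pi.sub_apply, Pi.smul_apply,
      Pi.smul_apply, hL.mulVec_green hS (fun h => haT (hST h)) hvS, hL.mulVec_green hT haT hv,
      if_neg hav, smul_zero, smul_zero, sub_self]
  · simp only [Pi.sub_apply, Pi.smul_apply, smul_eq_mul]
    rcases Finset.mem_insert.1 ha with rfl | ha
    · rw [inv_mul_cancel₀ (hL.green_diag_pos hS hvS).ne',
        inv_mul_cancel₀ (hL.green_diag_pos hT hv).ne', sub_self]
    · rw [green_of_mem_left ha, mul_zero, sub_zero]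
      exact mul_nonneg (inv_nonneg.2 (hL.green_nonneg hS v v)) (hL.green_nonneg hS a v)

theorem sum_green_sub_insert (hL : IsHubLaplacian L z) (hS : S.Nonempty) {v : ι} (hv : v ∉ S) :
    ∑ x, green L S x x - ∑ x, green L (insert v S) x x
      = ∑ x, green L S x v * (green L S x v / green L S v v) := by
  rw [← Finset.sum_sub_distrib]
  refine Finset.sum_congr rfl fun x _ => ?_
  rw [hL.green_insert hS hv, hL.green_comm v x, sub_sub_cancel]

/-- The trace of the inverse of the principal submatrix off `S` is supermodular in `S`. -/
theorem sum_green_supermodular (hL : IsHubLaplacian L z) (hS : S.Nonempty) (hST : S ⊆ T) {v : ι}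
    (hv : v ∉ T) :
    ∑ x, green L T x x - ∑ x, green L (insert v T) x x
      ≤ ∑ x, green L S x x - ∑ x, green L (insert v S) x x := by
  have hT := hS.mono hST
  rw [hL.sum_green_sub_insert hT hv, hL.sum_green_sub_insert hS fun h => hv (hST h)]
  exact Finset.sum_le_sum fun x _ => mul_le_mul (hL.green_antitone hS hST x v)
    (hL.green_div_antitone hS hST hv x)
    (div_nonneg (hL.green_nonneg hT x v) (hL.green_nonneg hT v v)) (hL.green_nonneg hS x v)

end IsHubLaplacian

end Green

section Greedy

variable {β : Type*} [DecidableEq β]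

/-- For a supermodular set function, the decrease from `A` to `A ∪ B` is bounded by the
cardinality of `B` times any nonnegative bound on the marginal decreases at `A`. -/
theorem sub_union_le_card_mul {f : Finset β → ℝ}
    (hsuper : ∀ A B : Finset β, A.Nonempty → A ⊆ B → ∀ v ∉ B,
      f B - f (insert v B) ≤ f A - f (insert v A))
    {A : Finset β} (hA : A.Nonempty) {c : ℝ} (hc : 0 ≤ c)
    (hgain : ∀ u ∉ A, f A - f (insert u A) ≤ c) (B : Finset β) :
    f A - f (A ∪ B) ≤ B.card * c := by
  induction B using Finset.induction_on with
  | empty => simp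
  | insert b B hb ih =>
    rw [Finset.card_insert_of_notMem hb, Finset.union_insert]
    push_cast
    by_cases hbA : b ∈ A ∪ B
    · rw [Finset.insert_eq_of_mem hbA]
      linarith
    · have h1 := hsuper A (A ∪ B) hA Finset.subset_union_left b hbA
      have h2 := hgain b fun h => hbA (Finset.mem_union_left B h)
      linarith

theorem one_sub_inv_pow_le {k : ℕ} (hk : 2 ≤ k) :
    (1 - (k : ℝ)⁻¹) ^ (k - 1) ≤ (k : ℝ) / (Real.exp 1 * ((k : ℝ) - 1)) := by
  have hk2 : (2 : ℝ) ≤ k := by exact_mod_cast hk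
  have hk0 : (0 : ℝ) < k := by linarith
  have hk1 : (0 : ℝ) < k - 1 := by linarith
  have hpow : (1 - (k : ℝ)⁻¹) ^ k ≤ Real.exp (-1) := by
    simpa using Real.one_sub_div_pow_le_exp_neg (n := k) (t := 1) (by linarith)
  have hsplit : (1 - (k : ℝ)⁻¹) ^ k = (1 - (k : ℝ)⁻¹) ^ (k - 1) * (((k : ℝ) - 1) / k) := by
    rw [← Nat.sub_add_cancel (show 1 ≤ k by omega), pow_succ, Nat.sub_add_cancel (by omega)]
    congr 1
    field_simp
  rw [hsplit, Real.exp_neg] at hpow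
  calc (1 - (k : ℝ)⁻¹) ^ (k - 1)
      = (1 - (k : ℝ)⁻¹) ^ (k - 1) * (((k : ℝ) - 1) / k) * (k / ((k : ℝ) - 1)) := by
        field_simp
    _ ≤ (Real.exp 1)⁻¹ * (k / ((k : ℝ) - 1)) :=
        mul_le_mul_of_nonneg_right hpow (by positivity)
    _ = (k : ℝ) / (Real.exp 1 * ((k : ℝ) - 1)) := by
        field_simp

/-- The greedy guarantee for antitone supermodular functions on nonempty sets, starting from a
given nonempty set `S 1`. -/
theorem greedy_guarantee_of_supermodular {f : Finset β → ℝ}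
    (hanti : ∀ A B : Finset β, A.Nonempty → A ⊆ B → f B ≤ f A)
    (hsuper : ∀ A B : Finset β, A.Nonempty → A ⊆ B → ∀ v ∉ B,
      f B - f (insert v B) ≤ f A - f (insert v A))
    {k : ℕ} (hk : 2 ≤ k) {S : ℕ → Finset β} (hS1 : (S 1).Nonempty)
    (hgreedy : ∀ i, 1 ≤ i → i < k → ∃ v ∉ S i, S (i + 1) = insert v (S i) ∧
      ∀ u ∉ S i, f (S i) - f (insert u (S i)) ≤ f (S i) - f (insert v (S i)))
    {B : Finset β} (hB : B.card = k) (hB1 : f B ≤ f (S 1)) :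
    (1 - (k : ℝ) / (Real.exp 1 * ((k : ℝ) - 1))) * (f (S 1) - f B) ≤ f (S 1) - f (S k) := by
  have hk0 : (2 : ℝ) ≤ k := by exact_mod_cast hk
  have hinv : (k : ℝ)⁻¹ ≤ 1 := inv_le_one_of_one_le₀ (by linarith)
  have hBne : B.Nonempty := Finset.card_pos.1 (by omega)
  have key : ∀ j, j + 1 ≤ k → (S (j + 1)).Nonempty ∧
      f (S (j + 1)) - f B ≤ (1 - (k : ℝ)⁻¹) ^ j * (f (S 1) - f B) := by
    intro j
    induction j with
    | zero => simp [hS1]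
    | succ j ih =>
      intro hj
      obtain ⟨hne, hle⟩ := ih (by omega)
      obtain ⟨v, -, hSv, hmax⟩ := hgreedy (j + 1) (by omega) (by omega)
      rw [← hSv] at hmax
      have hmono : f (S (j + 1 + 1)) ≤ f (S (j + 1)) :=
        hanti _ _ hne (hSv ▸ Finset.subset_insert v _)
      have h1 := sub_union_le_card_mul hsuper hne (sub_nonneg.2 hmono) hmax B
      have h2 := hanti B (S (j + 1) ∪ B) hBne Finset.subset_union_right
      rw [hB] at h1
      have h3 : (k : ℝ)⁻¹ * (f (S (j + 1)) - f B) ≤ f (S (j + 1)) - f (S (j + 1 + 1)) := by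
        rw [inv_mul_le_iff₀ (by linarith)]
        linarith
      refine ⟨hSv ▸ Finset.insert_nonempty v _, ?_⟩
      have h4 := mul_le_mul_of_nonneg_left hle (sub_nonneg.2 hinv)
      rw [pow_succ', mul_assoc]
      linarith
  have hfin := (key (k - 1) (by omega)).2
  rw [Nat.sub_add_cancel (by omega)] at hfin
  have hbound := mul_le_mul_of_nonneg_right (one_sub_inv_pow_le hk) (sub_nonneg.2 hB1)
  linarith

end Greedy

theorem isHubLaplacian_lapStar {W : Matrix V V ℝ} (hsym : ∀ u v, W u v = W v u)
    (hnn : ∀ u v, 0 ≤ W u v) {α : ℝ} (hα : 0 < α) : IsHubLaplacian (lapStar α W) none where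
  symm := by
    rintro (_ | x) (_ | y) <;> simp [lapStar, lap, Matrix.one_apply, Matrix.diagonal_apply]
    rcases eq_or_ne x y with rfl | h
    · rfl
    · simp [h, h.symm, hsym x y]
  offDiag_nonpos := by
    rintro (_ | x) (_ | y) h
    · exact absurd rfl h
    · simp [lapStar]
    · simp [lapStar]
    · have hxy : x ≠ y := fun e => h (congrArg some e)
      simpa [lapStar, lap, Matrix.one_apply, Matrix.diagonal_apply, hxy]
        using mul_nonneg hα.le (hnn x y)
  row_sum := by
    rintro (_ | x)
    · simp [Fintype.sum_option, lapStar]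
    · simp [Fintype.sum_option, lapStar, lap, Matrix.one_apply, Matrix.diagonal_apply,
        Finset.sum_add_distrib, ← Finset.mul_sum]
  hub_neg := by
    rintro (_ | x) h
    · exact absurd rfl h
    · simp [lapStar]

theorem gff_eq_sum_green (α : ℝ) (W : Matrix V V ℝ) (S : Finset V) :
    gff α W S = ∑ x, green (lapStar α W) (S.image some) x x :=
  trace_submatrix_inv _ _

theorem gff_supermodular {W : Matrix V V ℝ} (hsym : ∀ u v, W u v = W v u)
    (hnn : ∀ u v, 0 ≤ W u v) {α : ℝ} (hα : 0 < α) {A B : Finset V} (hA : A.Nonempty)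
    (hAB : A ⊆ B) {v : V} (hv : v ∉ B) :
    gff α W B - gff α W (insert v B) ≤ gff α W A - gff α W (insert v A) := by
  simp only [gff_eq_sum_green, Finset.image_insert]
  exact (isHubLaplacian_lapStar hsym hnn hα).sum_green_supermodular (hA.image some)
    (Finset.image_subset_image hAB) (by simpa using hv)

theorem gff_antitone {W : Matrix V V ℝ} (hsym : ∀ u v, W u v = W v u)
    (hnn : ∀ u v, 0 ≤ W u v) {α : ℝ} (hα : 0 < α) {A B : Finset V} (hA : A.Nonempty)
    (hAB : A ⊆ B) : gff α W B ≤ gff α W A := by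
  simp only [gff_eq_sum_green]
  exact Finset.sum_le_sum fun x _ => (isHubLaplacian_lapStar hsym hnn hα).green_antitone
    (hA.image some) (Finset.image_subset_image hAB) x x

/-- greedy guarantee for group forest farness minimization. If `v₀`
minimizes `f` over singletons, `S₁ = {v₀} ⊆ S₂ ⊆ … ⊆ S_k` is a greedy sequence, where
each step adds a vertex maximizing the marginal gain `f(S_i) - f(S_i ∪ {v})`, and `S̃`
is a minimizer of `f` among all size-`k` subsets, then
`f({v₀}) - f(S_k) ≥ (1 - k/(e·(k-1))) · (f({v₀}) - f(S̃))`. -/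
theorem gff_greedy_guarantee
    (W : Matrix V V ℝ) (hsym : ∀ u v, W u v = W v u) (hnn : ∀ u v, 0 ≤ W u v)
    (hdiag : ∀ v, W v v = 0)
    (hconn : (SimpleGraph.fromRel fun a b => W a b ≠ 0).Connected)
    (α : ℝ) (hα : 0 < α) (k : ℕ) (hk : 2 ≤ k) (hkn : k < Fintype.card V)
    (v₀ : V) (hv₀ : ∀ u : V, gff α W {v₀} ≤ gff α W {u})
    (S : ℕ → Finset V) (hS1 : S 1 = {v₀})
    (hgreedy : ∀ i, 1 ≤ i → i < k → ∃ v ∉ S i,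
      S (i + 1) = insert v (S i) ∧
      ∀ u ∉ S i, gff α W (S i) - gff α W (insert u (S i))
        ≤ gff α W (S i) - gff α W (insert v (S i)))
    (Sopt : Finset V) (hSoptCard : Sopt.card = k)
    (hSopt : ∀ T : Finset V, T.card = k → gff α W Sopt ≤ gff α W T) :
    gff α W {v₀} - gff α W (S k)
      ≥ (1 - (k : ℝ) / (Real.exp 1 * ((k : ℝ) - 1)))
        * (gff α W {v₀} - gff α W Sopt) := by
  have hanti : ∀ A B : Finset V, A.Nonempty → A ⊆ B → gff α W B ≤ gff α W A :=
    fun A B hA hAB => gff_antitone hsym hnn hα hA hAB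
  obtain ⟨T, hT0, -, hTk⟩ := Finset.exists_subsuperset_card_eq (n := k)
    (Finset.subset_univ {v₀}) (by rw [Finset.card_singleton]; omega) (by simpa using hkn.le)
  have hopt : gff α W Sopt ≤ gff α W {v₀} :=
    (hSopt T hTk).trans (hanti _ _ (Finset.singleton_nonempty v₀) hT0)
  rw [← hS1] at hopt ⊢
  exact greedy_guarantee_of_supermodular hanti
    (fun A B hA hAB v hv => gff_supermodular hsym hnn hα hA hAB hv) hk (by simp [hS1]) hgreedy
    hSoptCard hopt
end
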